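/- arXiv:0802.3110 — 5 statements merged into one kernel-verified Lean document; each statement's English description precedes it below -/
import Mathlib

section
/- Let 1/2 < q < 1 and α, β > 0, and define G_*(z) = α^{1/(q-1)} (1 + (β/α) z)^{1/(q-1)} for z ≥ 0. Let G : [0,∞) → [0,∞) be measurable with ∫_0^∞ G(z) dz = ∫_0^∞ G_*(z) dz and ∫_0^∞ z G(z) dz = ∫_0^∞ z G_*(z) dz (both integrals finite), and suppose z ↦ G(z)^q is integrable. Then ∫_0^∞ G(z)^q dz ≤ ∫_0^∞ G_*(z)^q dz; equivalently, H_q(G) ≤ H_q(G_*). -/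
open MeasureTheory Set Filter

/-- The Generalized Pareto function `G_*(z) = α^{1/(q-1)} (1 + (β/α) z)^{1/(q-1)}`
maximizes the Tsallis `q`-norm `∫ G^q` among nonnegative measurable functions on `[0,∞)`
with the same 0th and 1st moments, for `1/2 < q < 1`. -/
theorem tsallis_max_entropy_inequality
    (q α β : ℝ) (hq1 : 1 / 2 < q) (hq2 : q < 1) (hα : 0 < α) (hβ : 0 < β)
    (Gstar : ℝ → ℝ)
    (hGstar : ∀ z, 0 ≤ z → Gstar z = α ^ (1 / (q - 1)) * (1 + (β / α) * z) ^ (1 / (q - 1)))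
    (G : ℝ → ℝ) (hGmeas : Measurable G) (hGnn : ∀ z, 0 ≤ z → 0 ≤ G z)
    (hGint : IntegrableOn G (Ioi 0))
    (hGmom : IntegrableOn (fun z => z * G z) (Ioi 0))
    (h0 : ∫ z in Ioi (0 : ℝ), G z = ∫ z in Ioi (0 : ℝ), Gstar z)
    (h1 : ∫ z in Ioi (0 : ℝ), z * G z = ∫ z in Ioi (0 : ℝ), z * Gstar z)
    (hGq : IntegrableOn (fun z => G z ^ q) (Ioi 0)) :
    ∫ z in Ioi (0 : ℝ), G z ^ q ≤ ∫ z in Ioi (0 : ℝ), Gstar z ^ q := by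
  have hq' : q - 1 < 0 := by linarith
  have hqne : q - 1 ≠ 0 := hq'.ne
  set p : ℝ := 1 / (q - 1) with hp
  have hpq : p * (q - 1) = 1 := by rw [hp]; field_simp
  have hp2 : p < -2 := by
    rw [hp, div_lt_iff_of_neg hq']; linarith
  have hLpos : ∀ z : ℝ, 0 < z → 0 < α + β * z := fun z hz => by positivity
  have hS : ∀ z : ℝ, 0 < z → Gstar z = (α + β * z) ^ p := by
    intro z hz
    rw [hGstar z hz.le, ← Real.mul_rpow hα.le (by positivity)]
    congr 1
    field_simp
  have hSpos : ∀ z : ℝ, 0 < z → 0 < Gstar z := fun z hz => by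
    rw [hS z hz]; exact Real.rpow_pos_of_pos (hLpos z hz) _
  have hSq1 : ∀ z : ℝ, 0 < z → Gstar z ^ (q - 1) = α + β * z := fun z hz => by
    rw [hS z hz, ← Real.rpow_mul (hLpos z hz).le, hpq, Real.rpow_one]
  have hSq : ∀ z : ℝ, 0 < z → Gstar z ^ q = (α + β * z) * Gstar z := fun z hz => by
    rw [← hSq1 z hz, ← Real.rpow_add_one (hSpos z hz).ne']
    congr 1; ring
  have hpow : ∀ a : ℝ, a < -1 → IntegrableOn (fun z : ℝ => (α + β * z) ^ a) (Ioi 0) := by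
    intro a ha
    have h := (integrableOn_add_rpow_Ioi_of_lt (a := a) (c := 0) (m := α / β) ha
      (by have : 0 < α / β := by positivity
          linarith)).const_mul (β ^ a)
    refine IntegrableOn.congr_fun h ?_ measurableSet_Ioi
    intro z hz
    have hz : 0 < z := hz
    simp only
    rw [← Real.mul_rpow hβ.le (by positivity)]
    congr 1
    field_simp
    ring
  have hIS : IntegrableOn Gstar (Ioi 0) :=
    (hpow p (by linarith)).congr_fun (fun z hz => (hS z hz).symm) measurableSet_Ioi
  have hILS : IntegrableOn (fun z => (α + β * z) * Gstar z) (Ioi 0) := by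
    refine (hpow (p + 1) (by linarith)).congr_fun (fun z hz => ?_) measurableSet_Ioi
    simp only
    rw [hS z hz, Real.rpow_add_one (hLpos z hz).ne', mul_comm]
  have hIzS : IntegrableOn (fun z => z * Gstar z) (Ioi 0) := by
    refine IntegrableOn.congr_fun ((hILS.sub (hIS.const_mul α)).const_mul (β⁻¹)) (fun z hz => ?_)
      measurableSet_Ioi
    simp only [Pi.sub_apply]
    field_simp
    ring
  have hkey : ∀ z : ℝ, 0 < z → G z ^ q ≤
      q * α * G z + q * β * (z * G z) + ((1 - q) * α * Gstar z + (1 - q) * β * (z * Gstar z)) := by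
    intro z hz
    have h := Real.geom_mean_le_arith_mean2_weighted (w₁ := q) (w₂ := 1 - q) (by linarith)
      (by linarith) (hGnn z hz.le) (hSpos z hz).le (by ring)
    have h2 := mul_le_mul_of_nonneg_right h (hLpos z hz).le
    have h3 : Gstar z ^ (1 - q) * (α + β * z) = 1 := by
      rw [← hSq1 z hz, ← Real.rpow_add (hSpos z hz)]
      simp
    rw [mul_assoc, h3, mul_one] at h2
    linarith
  have hA := hGint.const_mul (q * α)
  have hB := hGmom.const_mul (q * β)
  have hC := hIS.const_mul ((1 - q) * α)
  have hD := hIzS.const_mul ((1 - q) * β)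
  have hle := setIntegral_mono_on hGq ((hA.add hB).add (hC.add hD)) measurableSet_Ioi
    (fun z hz => hkey z hz)
  have e1 : ∫ z in Ioi (0 : ℝ), Gstar z ^ q
      = α * (∫ z in Ioi (0 : ℝ), Gstar z) + β * ∫ z in Ioi (0 : ℝ), z * Gstar z := by
    rw [← integral_const_mul, ← integral_const_mul,
      ← integral_add (hIS.const_mul α) (hIzS.const_mul β)]
    refine setIntegral_congr_fun measurableSet_Ioi (fun z hz => ?_)
    rw [hSq z hz]; ring
  rw [integral_add' (hA.add hB) (hC.add hD), integral_add' hA hB, integral_add' hC hD,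
    integral_const_mul, integral_const_mul, integral_const_mul, integral_const_mul, h0, h1] at hle
  rw [e1]
  linarith
end

section
/- Let 1/2 < q < 1 and α, β > 0, and define G_*(z) = α^{1/(q-1)} (1 + (β/α) z)^{1/(q-1)} for z ≥ 0. If G : [0,∞) → [0,∞) is measurable, satisfies ∫_0^∞ G(z) dz = ∫_0^∞ G_*(z) dz and ∫_0^∞ z G(z) dz = ∫_0^∞ z G_*(z) dz (both finite), and ∫_0^∞ G(z)^q dz = ∫_0^∞ G_*(z)^q dz, then G = G_* almost everywhere on [0,∞). -/
open MeasureTheory Set Filter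

/-- Uniqueness of the Tsallis maximum entropy solution: if a nonnegative measurable `G`
on `[0,∞)` has the same 0th and 1st moments as the Generalized Pareto function
`G_*(z) = α^{1/(q-1)} (1 + (β/α) z)^{1/(q-1)}` and achieves the same `q`-norm
`∫ G^q = ∫ G_*^q` (with `1/2 < q < 1`), then `G = G_*` almost everywhere on `[0,∞)`. -/
theorem tsallis_max_entropy_unique
    (q α β : ℝ) (hq1 : 1 / 2 < q) (hq2 : q < 1) (hα : 0 < α) (hβ : 0 < β)
    (Gstar : ℝ → ℝ)
    (hGstar : ∀ z, 0 ≤ z → Gstar z = α ^ (1 / (q - 1)) * (1 + (β / α) * z) ^ (1 / (q - 1)))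
    (G : ℝ → ℝ) (hGmeas : Measurable G) (hGnn : ∀ z, 0 ≤ z → 0 ≤ G z)
    (hGint : IntegrableOn G (Ioi 0))
    (hGmom : IntegrableOn (fun z => z * G z) (Ioi 0))
    (h0 : ∫ z in Ioi (0 : ℝ), G z = ∫ z in Ioi (0 : ℝ), Gstar z)
    (h1 : ∫ z in Ioi (0 : ℝ), z * G z = ∫ z in Ioi (0 : ℝ), z * Gstar z)
    (hGq : IntegrableOn (fun z => G z ^ q) (Ioi 0))
    (heq : ∫ z in Ioi (0 : ℝ), G z ^ q = ∫ z in Ioi (0 : ℝ), Gstar z ^ q) :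
    ∀ᵐ z ∂(volume.restrict (Ioi (0 : ℝ))), G z = Gstar z := by
  have hq3 : q - 1 < 0 := by linarith
  set a : ℝ := 1 / (q - 1) with ha
  have haq : a * (q - 1) = 1 := by rw [ha]; field_simp [hq3.ne]
  have ha2 : a < -2 := by
    by_contra! h
    nlinarith
  have hA : ∀ z : ℝ, 0 < z → 0 < α + β * z := fun z hz => by positivity
  have hG1 : ∀ z : ℝ, 0 < z → Gstar z = (α + β * z) ^ a := by
    intro z hz
    rw [hGstar z hz.le, ← Real.mul_rpow hα.le (by positivity)]
    congr 1
    field_simp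
  have hG2 : ∀ z : ℝ, 0 < z → Gstar z = β ^ a * (z + α / β) ^ a := by
    intro z hz
    rw [hG1 z hz, ← Real.mul_rpow hβ.le (by positivity)]
    congr 1
    field_simp
    ring
  have hpos : ∀ z : ℝ, 0 < z → 0 < Gstar z := fun z hz => by
    rw [hG1 z hz]; exact Real.rpow_pos_of_pos (hA z hz) _
  have hGA : ∀ z : ℝ, 0 < z → Gstar z ^ q = (α + β * z) * Gstar z := by
    intro z hz
    have hAz := hA z hz
    rw [hG1 z hz, ← Real.rpow_mul hAz.le, show a * q = 1 + a by linarith,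
      Real.rpow_add hAz, Real.rpow_one]
  have hm : -(α / β) < 0 := by
    have := div_pos hα hβ
    linarith
  have iS : IntegrableOn Gstar (Ioi 0) := by
    refine IntegrableOn.congr_fun ((integrableOn_add_rpow_Ioi_of_lt (a := a)
      (by linarith) hm).const_mul (β ^ a)) ?_ measurableSet_Ioi
    intro z hz
    exact (hG2 z hz).symm
  have iS' : IntegrableOn (fun z => (z + α / β) * Gstar z) (Ioi 0) := by
    refine IntegrableOn.congr_fun ((integrableOn_add_rpow_Ioi_of_lt (a := 1 + a)
      (by linarith) hm).const_mul (β ^ a)) ?_ measurableSet_Ioi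
    intro z hz
    have hz' : (0 : ℝ) < z := hz
    have h3 : 0 < z + α / β := by positivity
    simp only
    rw [hG2 z hz, Real.rpow_add h3, Real.rpow_one]
    ring
  have izS : IntegrableOn (fun z => z * Gstar z) (Ioi 0) := by
    refine IntegrableOn.congr_fun (iS'.sub (iS.const_mul (α / β))) ?_ measurableSet_Ioi
    intro z hz
    simp only [Pi.sub_apply]
    ring
  have hSq : ∫ z in Ioi (0 : ℝ), Gstar z ^ q
      = α * (∫ z in Ioi (0 : ℝ), Gstar z) + β * ∫ z in Ioi (0 : ℝ), z * Gstar z := by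
    rw [← integral_const_mul, ← integral_const_mul,
      ← integral_add (iS.const_mul α) (izS.const_mul β)]
    refine setIntegral_congr_fun measurableSet_Ioi ?_
    intro z hz
    simp only
    rw [hGA z hz]
    ring
  -- the Bregman gap
  have key : ∀ z : ℝ, 0 < z → G z ≠ Gstar z →
      G z ^ q < (1 - q) * ((α + β * z) * Gstar z) + q * (α * G z + β * (z * G z)) := by
    intro z hz hne
    have hs := hpos z hz
    have hg := hGnn z hz.le
    have hx : -1 ≤ G z / Gstar z - 1 := by
      have := div_nonneg hg hs.le
      linarith
    have hx0 : G z / Gstar z - 1 ≠ 0 := by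
      intro h
      apply hne
      have : G z / Gstar z = 1 := by linarith
      rwa [div_eq_one_iff_eq hs.ne'] at this
    have hb := rpow_one_add_lt_one_add_mul_self hx hx0 (by linarith : 0 < q) hq2
    rw [add_sub_cancel, Real.div_rpow hg hs.le, div_lt_iff₀ (Real.rpow_pos_of_pos hs q),
      hGA z hz] at hb
    refine hb.trans_eq ?_
    field_simp
    ring
  have keyeq : ∀ z : ℝ, 0 < z → G z = Gstar z →
      G z ^ q = (1 - q) * ((α + β * z) * Gstar z) + q * (α * G z + β * (z * G z)) := by
    intro z hz h
    rw [h, hGA z hz]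
    ring
  let S : ℝ → ℝ := fun z => (1 - q) * (α * Gstar z + β * (z * Gstar z))
  let T : ℝ → ℝ := fun z => q * (α * G z + β * (z * G z))
  have iSS : IntegrableOn S (Ioi 0) :=
    ((iS.const_mul α).add (izS.const_mul β)).const_mul (1 - q)
  have iT : IntegrableOn T (Ioi 0) :=
    ((hGint.const_mul α).add (hGmom.const_mul β)).const_mul q
  have iST : IntegrableOn (fun z => S z + T z) (Ioi 0) := iSS.add iT
  have iphi : IntegrableOn (fun z => (S z + T z) - G z ^ q) (Ioi 0) := iST.sub hGq
  have hzero : ∫ z in Ioi (0 : ℝ), ((S z + T z) - G z ^ q) = 0 := by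
    rw [integral_sub iST hGq, integral_add iSS iT, heq, hSq]
    simp only [S, T]
    rw [integral_const_mul, integral_const_mul,
      integral_add (iS.const_mul α) (izS.const_mul β),
      integral_add (hGint.const_mul α) (hGmom.const_mul β),
      integral_const_mul, integral_const_mul, integral_const_mul, integral_const_mul, h0, h1]
    ring
  have hnn : 0 ≤ᵐ[volume.restrict (Ioi (0 : ℝ))] fun z => (S z + T z) - G z ^ q := by
    filter_upwards [ae_restrict_mem measurableSet_Ioi] with z hz
    simp only [S, T, Pi.zero_apply]
    by_cases h : G z = Gstar z
    · have := keyeq z hz h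
      linarith
    · have := key z hz h
      linarith
  have hae := (integral_eq_zero_iff_of_nonneg_ae hnn iphi).1 hzero
  filter_upwards [hae, ae_restrict_mem measurableSet_Ioi] with z h hz
  by_contra hne
  have := key z hz hne
  simp only [S, T, Pi.zero_apply] at h
  linarith
end

section
/- Let a > 2, and let S : (0,∞) → (0,∞) be a measurable nonincreasing function such that S(z) = z^{−a} l(z), where l : (0,∞) → (0,∞) is slowly varying at infinity. Then (1/u²) ∫_0^∞ z · S(z+u)/S(u) dz → 1/((a−1)(a−2)) as u → ∞. -/
open MeasureTheory Set Filter

lemma potter_aux (S : ℝ → ℝ) (b u0 : ℝ) (hb : 0 < b) (hu0 : 0 < u0)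
    (hSpos : ∀ z, 0 < z → 0 < S z) (hSmono : AntitoneOn S (Ioi 0))
    (h2 : ∀ v, u0 ≤ v → S (2 * v) ≤ 2 ^ (-b) * S v) (u y : ℝ) (hu : u0 ≤ u) (hy : 1 ≤ y) :
    S (u * y) / S u ≤ 2 ^ b * y ^ (-b) := by
  have hup : 0 < u := hu0.trans_le hu
  have hyp : 0 < y := by linarith
  have key : ∀ n : ℕ, S (2 ^ n * u) ≤ ((2:ℝ) ^ n) ^ (-b) * S u := by
    intro n
    induction n with
    | zero => simp
    | succ n ih =>
      have h1 : (1:ℝ) ≤ 2 ^ n := one_le_pow₀ (by norm_num)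
      have h3 := h2 (2 ^ n * u) (by nlinarith)
      have e : (2:ℝ) ^ (n+1) * u = 2 * (2 ^ n * u) := by ring
      rw [e, pow_succ', Real.mul_rpow (by norm_num) (by positivity), mul_assoc]
      exact h3.trans (mul_le_mul_of_nonneg_left ih (by positivity))
  obtain ⟨n, hn1, hn2⟩ := exists_nat_pow_near hy (one_lt_two : (1:ℝ) < 2)
  rw [div_le_iff₀ (hSpos u hup)]
  have h3 : S (u * y) ≤ S (2 ^ n * u) :=
    hSmono (by simp only [mem_Ioi]; positivity) (by simp only [mem_Ioi]; positivity) (by nlinarith)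
  refine (h3.trans (key n)).trans (mul_le_mul_of_nonneg_right ?_ (hSpos u hup).le)
  have h4 : ((2:ℝ) ^ n) ^ (-b) ≤ (y / 2) ^ (-b) :=
    Real.rpow_le_rpow_of_nonpos (by positivity) (by rw [pow_succ] at hn2; linarith) (by linarith)
  refine h4.trans (le_of_eq ?_)
  rw [Real.div_rpow hyp.le (by norm_num), Real.rpow_neg (by norm_num : (0:ℝ) ≤ 2)]
  field_simp

/-- Asymptotics of the first moment of the excess survival function `S_u(z) = S(z+u)/S(u)`
for a survival function in the Fréchet domain of attraction with tail index `a > 2`: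
`(1/u²) ∫_0^∞ z S(z+u)/S(u) dz → 1/((a-1)(a-2))` as `u → ∞`. -/
theorem frechet_excess_first_moment
    (a : ℝ) (ha : 2 < a)
    (S l : ℝ → ℝ) (hSmeas : Measurable S)
    (hSpos : ∀ z, 0 < z → 0 < S z)
    (hSmono : AntitoneOn S (Ioi 0))
    (hlpos : ∀ z, 0 < z → 0 < l z)
    (hlslow : ∀ t, 0 < t → Tendsto (fun z => l (t * z) / l z) atTop (nhds 1))
    (hS : ∀ z, 0 < z → S z = z ^ (-a) * l z) :
    Tendsto (fun u => (1 / u ^ 2) * ∫ z in Ioi (0 : ℝ), z * (S (z + u) / S u))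
        atTop (nhds (1 / ((a - 1) * (a - 2)))) := by
  -- regular variation of S
  have hRV : ∀ t, 0 < t → Tendsto (fun z => S (z * t) / S z) atTop (nhds (t ^ (-a))) := by
    intro t ht
    have h := (hlslow t ht).const_mul (t ^ (-a))
    rw [mul_one] at h
    refine h.congr' ?_
    filter_upwards [eventually_gt_atTop 0] with z hz
    rw [hS z hz, hS (z * t) (by positivity), Real.mul_rpow hz.le ht.le, mul_comm z t]
    have := hlpos z hz
    have : 0 < z ^ (-a) := by positivity
    field_simp
  -- change of variables
  have hcv : ∀ u, 0 < u → (1 / u ^ 2) * ∫ z in Ioi (0 : ℝ), z * (S (z + u) / S u)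
      = ∫ y in Ioi (1:ℝ), (y - 1) * (S (u * y) / S u) := by
    intro u hu
    have e1 : ∫ z in Ioi (0 : ℝ), z * (S (z + u) / S u)
        = ∫ z in Ioi u, (z - u) * (S z / S u) := by
      have h := (measurePreserving_add_right volume u).setIntegral_preimage_emb
        (measurableEmbedding_addRight u) (fun z => (z - u) * (S z / S u)) (Ioi u)
      rw [← h]
      simp
    have e2 := integral_comp_mul_left_Ioi (fun z => (z - u) * (S z / S u)) 1 hu
    rw [mul_one] at e2
    have e3 : ∀ y, (u * y - u) * (S (u * y) / S u) = u * ((y - 1) * (S (u * y) / S u)) := by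
      intro y; ring
    simp only [e3, integral_const_mul, smul_eq_mul] at e2
    rw [e1]
    field_simp at e2 ⊢
    linarith
  -- the limit integral
  have hlim : ∫ y in Ioi (1:ℝ), (y - 1) * y ^ (-a) = 1 / ((a - 1) * (a - 2)) := by
    have e : ∫ y in Ioi (1:ℝ), (y - 1) * y ^ (-a)
        = ∫ y in Ioi (1:ℝ), (y ^ (1-a) - y ^ (-a)) := by
      refine setIntegral_congr_fun measurableSet_Ioi fun y hy => ?_
      have hy0 : (0:ℝ) < y := lt_trans one_pos hy
      have : y ^ (1 - a) = y * y ^ (-a) := by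
        rw [sub_eq_add_neg, Real.rpow_add hy0, Real.rpow_one]
      simp only [this]; ring
    rw [e, integral_sub (integrableOn_Ioi_rpow_of_lt (by linarith) one_pos)
      (integrableOn_Ioi_rpow_of_lt (by linarith) one_pos),
      integral_Ioi_rpow_of_lt (by linarith) one_pos, integral_Ioi_rpow_of_lt (by linarith) one_pos]
    simp only [Real.one_rpow]
    have h1 : a - 1 ≠ 0 := by linarith
    have h2 : a - 2 ≠ 0 := by linarith
    have h3 : 1 - a + 1 = -(a - 2) := by ring
    have h4 : -a + 1 = -(a - 1) := by ring
    rw [h3, h4]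
    field_simp
    ring
  obtain ⟨b, hb2, hba⟩ := exists_between ha
  have hlt : (2:ℝ) ^ (-a) < 2 ^ (-b) := Real.rpow_lt_rpow_of_exponent_lt (by norm_num) (by linarith)
  obtain ⟨u1, hu1⟩ := eventually_atTop.1 ((hRV 2 two_pos).eventually (gt_mem_nhds hlt))
  have hP := potter_aux S b (max u1 1) (by linarith) (by positivity) hSpos hSmono (by
    intro v hv
    have h := hu1 v ((le_max_left _ _).trans hv)
    have hv0 : 0 < v := lt_of_lt_of_le one_pos ((le_max_right _ _).trans hv)
    rw [div_lt_iff₀ (hSpos v hv0), mul_comm v] at h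
    exact h.le)
  rw [← hlim]
  have main : Tendsto (fun u => ∫ y in Ioi (1:ℝ), (y - 1) * (S (u * y) / S u)) atTop
      (nhds (∫ y in Ioi (1:ℝ), (y - 1) * y ^ (-a))) := by
    refine tendsto_integral_filter_of_dominated_convergence (fun y => 2 ^ b * y ^ (1 - b)) ?_ ?_ ?_ ?_
    · refine Eventually.of_forall fun u => Measurable.aestronglyMeasurable ?_
      fun_prop
    · filter_upwards [eventually_ge_atTop (max u1 1)] with u hu
      refine (ae_restrict_iff' measurableSet_Ioi).2 (ae_of_all _ fun y hy => ?_)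
      have hy1 : (1:ℝ) < y := hy
      have hy0 : (0:ℝ) < y := lt_trans one_pos hy
      have hu0 : 0 < u := lt_of_lt_of_le one_pos ((le_max_right _ _).trans hu)
      have hp := hSpos (u * y) (by positivity)
      have hq := hSpos u hu0
      have hpq : 0 < S (u * y) / S u := by positivity
      rw [Real.norm_of_nonneg (mul_nonneg (by linarith) hpq.le), sub_eq_add_neg y, sub_eq_add_neg 1 b,
        Real.rpow_add hy0, Real.rpow_one]
      have := hP u y hu hy1.le
      calc (y + -1) * (S (u * y) / S u) ≤ y * (2 ^ b * y ^ (-b)) :=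
            mul_le_mul (by linarith) this hpq.le hy0.le
        _ = _ := by ring
    · exact (integrableOn_Ioi_rpow_of_lt (by linarith) one_pos).const_mul _
    · refine (ae_restrict_iff' measurableSet_Ioi).2 (ae_of_all _ fun y hy => ?_)
      exact (hRV y (lt_trans one_pos hy)).const_mul _
  refine main.congr' ?_
  filter_upwards [eventually_gt_atTop 0] with u hu
  exact (hcv u hu).symm
end

section
/- Let a > 2 and q ∈ (1/2, 1], let S : (0,∞) → (0,∞) be a measurable nonincreasing function with S(z) = z^{−a} l(z) for a slowly varying l, and let g : (0,∞) → (0,∞) satisfy g(u)/u → 1 as u → ∞. Define S_{Y_u}(z) = S(z g(u) + u)/S(u), the survival function of the normalized excess Y_u = (X − u)/g(u) | X > u. Then, as u → ∞: ∫_0^∞ S_{Y_u}(z)^q dz → 1/(aq − 1), ∫_0^∞ S_{Y_u}(z) dz → 1/(a − 1), and ∫_0^∞ z S_{Y_u}(z) dz → 1/((a−1)(a−2)). -/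
open MeasureTheory Set Filter

lemma aux_lim (a : ℝ) (S l : ℝ → ℝ)
    (hSpos : ∀ z, 0 < z → 0 < S z)
    (hlpos : ∀ z, 0 < z → 0 < l z)
    (hlslow : ∀ t, 0 < t → Tendsto (fun z => l (t * z) / l z) atTop (nhds 1))
    (hS : ∀ z, 0 < z → S z = z ^ (-a) * l z) (t : ℝ) (ht : 0 < t) :
    Tendsto (fun u => S (t * u) / S u) atTop (nhds (t ^ (-a))) := by
  have h := (hlslow t ht).const_mul (t ^ (-a))
  rw [mul_one] at h
  refine h.congr' ?_
  filter_upwards [eventually_gt_atTop 0] with u hu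
  rw [hS _ hu, hS _ (mul_pos ht hu), Real.mul_rpow ht.le hu.le]
  have h1 := (Real.rpow_pos_of_pos hu (-a)).ne'
  have h2 := (hlpos u hu).ne'
  field_simp

lemma aux_potter (a b : ℝ) (hb : b < a) (hb0 : 0 < b) (S : ℝ → ℝ)
    (hSpos : ∀ z, 0 < z → 0 < S z)
    (hSmono : AntitoneOn S (Ioi 0))
    (hlim : ∀ t, 0 < t → Tendsto (fun u => S (t * u) / S u) atTop (nhds (t ^ (-a)))) :
    ∀ᶠ u in atTop, ∀ t, 1 ≤ t → S (t * u) / S u ≤ 2 ^ b * t ^ (-b) := by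
  have h2 : (2:ℝ) ^ (-a) < 2 ^ (-b) :=
    Real.rpow_lt_rpow_of_exponent_lt (by norm_num) (by linarith)
  have h3 := (hlim 2 (by norm_num)).eventually_lt_const h2
  obtain ⟨U, hU⟩ := eventually_atTop.1 h3
  filter_upwards [eventually_ge_atTop U, eventually_gt_atTop 0] with u hu hu0 t ht
  have key : ∀ n : ℕ, S (2 ^ n * u) ≤ ((2:ℝ) ^ (-b)) ^ n * S u := by
    intro n
    induction n with
    | zero => simp
    | succ k ih =>
      have hp : (1:ℝ) ≤ 2 ^ k := one_le_pow₀ (by norm_num)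
      have hpos : 0 < (2:ℝ) ^ k * u := by positivity
      have h := hU (2 ^ k * u) (by nlinarith)
      rw [div_lt_iff₀ (hSpos _ hpos)] at h
      have e : (2:ℝ) ^ (k+1) * u = 2 * (2 ^ k * u) := by ring
      rw [e]
      calc S (2 * (2 ^ k * u)) ≤ 2 ^ (-b) * S (2 ^ k * u) := h.le
        _ ≤ 2 ^ (-b) * (((2:ℝ) ^ (-b)) ^ k * S u) := by gcongr
        _ = _ := by ring
  obtain ⟨n, hn1, hn2⟩ := exists_nat_pow_near ht (by norm_num : (1:ℝ) < 2)
  rw [div_le_iff₀ (hSpos _ hu0)]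
  have hpos : 0 < (2:ℝ) ^ n * u := by positivity
  have ht0 : 0 < t := by linarith
  have hm : S (t * u) ≤ S (2 ^ n * u) :=
    hSmono hpos (mul_pos ht0 hu0) (by gcongr)
  refine hm.trans ((key n).trans ?_)
  have := hSpos u hu0
  gcongr
  have h4 : ((2:ℝ) ^ (n+1)) ^ (-b) ≤ t ^ (-b) :=
    Real.rpow_le_rpow_of_nonpos ht0 hn2.le (by linarith)
  have h5 : ((2:ℝ) ^ (n+1)) ^ (-b) = (2 ^ (-b)) ^ (n+1) := by
    rw [← Real.rpow_natCast, ← Real.rpow_natCast, ← Real.rpow_mul (by norm_num),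
      ← Real.rpow_mul (by norm_num), mul_comm]
  have h6 : (2:ℝ) ^ b * 2 ^ (-b) = 1 := by
    rw [← Real.rpow_add (by norm_num)]; simp
  calc ((2:ℝ) ^ (-b)) ^ n = 2 ^ b * (2 ^ (-b)) ^ (n+1) := by
        rw [pow_succ]; linear_combination (-(2 ^ (-b)) ^ n) * h6
    _ ≤ _ := by rw [← h5]; gcongr

lemma aux_lim' (a : ℝ) (S : ℝ → ℝ)
    (hSpos : ∀ z, 0 < z → 0 < S z)
    (hSmono : AntitoneOn S (Ioi 0))
    (hlim : ∀ t, 0 < t → Tendsto (fun u => S (t * u) / S u) atTop (nhds (t ^ (-a))))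
    (T : ℝ) (hT : 0 < T) (τ : ℝ → ℝ) (hτ : Tendsto τ atTop (nhds T)) :
    Tendsto (fun u => S (τ u * u) / S u) atTop (nhds (T ^ (-a))) := by
  have hc : ContinuousAt (fun t : ℝ => t ^ (-a)) T :=
    Real.continuousAt_rpow_const _ _ (Or.inl hT.ne')
  rw [tendsto_order]
  constructor
  · intro c hcT
    have h1 : ∀ᶠ t in nhds T, c < t ^ (-a) := hc.eventually_const_lt hcT
    have h2 : ∀ᶠ t in nhdsWithin T (Ioi T), c < t ^ (-a) ∧ T < t :=
      (h1.filter_mono nhdsWithin_le_nhds).and self_mem_nhdsWithin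
    obtain ⟨t, ht, htT⟩ := h2.exists
    filter_upwards [(hlim t (hT.trans htT)).eventually_const_lt ht,
      hτ.eventually_lt_const htT, hτ.eventually_const_lt hT, eventually_gt_atTop 0]
      with u h3 h4 h5 h6
    refine h3.trans_le ?_
    have := hSpos u h6
    gcongr
    exact hSmono (mul_pos h5 h6) (mul_pos (hT.trans htT) h6) (by gcongr)
  · intro c hcT
    have h1 : ∀ᶠ t in nhds T, t ^ (-a) < c ∧ 0 < t :=
      (hc.eventually_lt_const hcT).and (lt_mem_nhds hT)
    have h2 : ∀ᶠ t in nhdsWithin T (Iio T), (t ^ (-a) < c ∧ 0 < t) ∧ t < T :=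
      (h1.filter_mono nhdsWithin_le_nhds).and self_mem_nhdsWithin
    obtain ⟨t, ⟨ht, ht0⟩, htT⟩ := h2.exists
    filter_upwards [(hlim t ht0).eventually_lt_const ht,
      hτ.eventually_const_lt htT, eventually_gt_atTop 0]
      with u h3 h4 h6
    refine lt_of_le_of_lt ?_ h3
    have := hSpos u h6
    gcongr
    exact hSmono (mul_pos ht0 h6) (mul_pos (ht0.trans h4) h6) (by gcongr)

lemma aux_int (c : ℝ) (hc : 1 < c) :
    IntegrableOn (fun z : ℝ => (z + 1) ^ (-c)) (Ioi 0) ∧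
    ∫ z in Ioi (0:ℝ), (z + 1) ^ (-c) = 1 / (c - 1) := by
  constructor
  · exact integrableOn_add_rpow_Ioi_of_lt (by linarith) (by norm_num)
  · have h := (measurePreserving_add_right (volume : Measure ℝ) 1).setIntegral_preimage_emb
      (measurableEmbedding_addRight (1:ℝ)) (fun z : ℝ => z ^ (-c)) (Ioi 1)
    rw [preimage_add_const_Ioi, sub_self] at h
    rw [h, integral_Ioi_rpow_of_lt (by linarith) (by norm_num)]
    simp only [Real.one_rpow]
    rw [neg_div, ← div_neg]; congr 1; ring

theorem frechet_normalized_excess_asymptotics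
    (a q : ℝ) (ha : 2 < a) (hq1 : 1 / 2 < q) (hq2 : q ≤ 1)
    (S l : ℝ → ℝ) (hSmeas : Measurable S)
    (hSpos : ∀ z, 0 < z → 0 < S z)
    (hSmono : AntitoneOn S (Ioi 0))
    (hlpos : ∀ z, 0 < z → 0 < l z)
    (hlslow : ∀ t, 0 < t → Tendsto (fun z => l (t * z) / l z) atTop (nhds 1))
    (hS : ∀ z, 0 < z → S z = z ^ (-a) * l z)
    (g : ℝ → ℝ) (hgpos : ∀ u, 0 < u → 0 < g u)
    (hg : Tendsto (fun u => g u / u) atTop (nhds 1)) :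
    Tendsto (fun u => ∫ z in Ioi (0 : ℝ), (S (z * g u + u) / S u) ^ q)
        atTop (nhds (1 / (a * q - 1))) ∧
    Tendsto (fun u => ∫ z in Ioi (0 : ℝ), S (z * g u + u) / S u)
        atTop (nhds (1 / (a - 1))) ∧
    Tendsto (fun u => ∫ z in Ioi (0 : ℝ), z * (S (z * g u + u) / S u))
        atTop (nhds (1 / ((a - 1) * (a - 2)))) := by
  have hlim := aux_lim a S l hSpos hlpos hlslow hS
  obtain ⟨b, hb2, hba⟩ := exists_between ha
  have hpot := aux_potter a b hba (by linarith) S hSpos hSmono hlim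
  -- pointwise limit
  have hpt : ∀ z : ℝ, 0 < z →
      Tendsto (fun u => S (z * g u + u) / S u) atTop (nhds ((z + 1) ^ (-a))) := by
    intro z hz
    have h := aux_lim' a S hSpos hSmono hlim (z + 1) (by linarith)
      (fun u => z * (g u / u) + 1) (by simpa using (hg.const_mul z).add_const 1)
    refine h.congr' ?_
    filter_upwards [eventually_gt_atTop 0] with u hu
    congr 2
    field_simp
  -- domination
  obtain ⟨C, hC0, hdom⟩ : ∃ C : ℝ, 0 ≤ C ∧ ∀ᶠ u in atTop, ∀ z : ℝ, 0 < z →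
      0 ≤ S (z * g u + u) / S u ∧ S (z * g u + u) / S u ≤ C * (z + 1) ^ (-b) := by
    refine ⟨2 ^ b * (1 / 2) ^ (-b), by positivity, ?_⟩
    filter_upwards [hpot, eventually_gt_atTop 0,
      hg.eventually_const_lt (by norm_num : (1 / 2 : ℝ) < 1)] with u h1 h2 h3 z hz
    have hgu := hgpos u h2
    rw [lt_div_iff₀ h2] at h3
    have hp : 0 < z * g u + u := by positivity
    have hSu := hSpos u h2
    refine ⟨(div_pos (hSpos _ hp) hSu).le, ?_⟩
    have e : (z * g u + u) = ((z * g u + u) / u) * u := by field_simp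
    have ht : 1 ≤ (z * g u + u) / u := by
      rw [le_div_iff₀ h2]; nlinarith [mul_pos hz hgu]
    have ht' : 1 / 2 * (z + 1) ≤ (z * g u + u) / u := by
      rw [le_div_iff₀ h2]; nlinarith
    have := h1 _ ht
    rw [← e] at this
    refine this.trans ?_
    rw [mul_assoc, ← Real.mul_rpow (by norm_num) (by linarith)]
    gcongr 2 ^ b * ?_
    exact Real.rpow_le_rpow_of_nonpos (by positivity) ht' (by linarith)
  have hmeas : ∀ u, Measurable (fun z => S (z * g u + u) / S u) := fun u =>
    (hSmeas.comp (by fun_prop)).div_const _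
  have part1 : ∀ p : ℝ, 1 / 2 < p →
      Tendsto (fun u => ∫ z in Ioi (0 : ℝ), (S (z * g u + u) / S u) ^ p)
        atTop (nhds (1 / (a * p - 1))) := by
    intro p hp
    rw [← (aux_int (a * p) (by nlinarith)).2]
    refine tendsto_integral_filter_of_dominated_convergence
      (fun z => C ^ p * (z + 1) ^ (-(b * p))) ?_ ?_ ?_ ?_
    · exact Eventually.of_forall fun u => ((hmeas u).pow_const p).aestronglyMeasurable
    · filter_upwards [hdom] with u hu
      filter_upwards [ae_restrict_mem measurableSet_Ioi] with z hz
      have hz : 0 < z := hz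
      obtain ⟨h0, h1⟩ := hu z hz
      rw [Real.norm_of_nonneg (Real.rpow_nonneg h0 _)]
      calc _ ≤ (C * (z + 1) ^ (-b)) ^ p := Real.rpow_le_rpow h0 h1 (by linarith)
        _ = _ := by
          rw [Real.mul_rpow hC0 (by positivity), ← Real.rpow_mul (by linarith), neg_mul]
    · exact (aux_int (b * p) (by nlinarith)).1.const_mul _
    · filter_upwards [ae_restrict_mem measurableSet_Ioi] with z hz
      have hz : 0 < z := hz
      have h := (hpt z hz).rpow_const (p := p) (Or.inr (by linarith))
      rwa [← Real.rpow_mul (by linarith), neg_mul] at h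
  refine ⟨part1 q hq1, by simpa using part1 1 (by norm_num), ?_⟩
  have hid : ∀ c z : ℝ, 0 < z → z * (z + 1) ^ (-c) = (z + 1) ^ (-(c - 1)) - (z + 1) ^ (-c) := by
    intro c z hz
    rw [show -(c - 1) = -c + 1 by ring, Real.rpow_add_one (by linarith)]
    ring
  have hval : ∫ z in Ioi (0:ℝ), z * (z + 1) ^ (-a) = 1 / ((a - 1) * (a - 2)) := by
    rw [setIntegral_congr_fun measurableSet_Ioi (fun z hz => hid a z hz)]
    obtain ⟨i1, e1⟩ := aux_int (a - 1) (by linarith)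
    obtain ⟨i2, e2⟩ := aux_int a (by linarith)
    rw [integral_sub i1 i2, e1, e2]
    have h1 : a - 1 ≠ 0 := by linarith
    have h2 : a - 2 ≠ 0 := by linarith
    rw [show a - 1 - 1 = a - 2 by ring]
    field_simp
    ring
  rw [← hval]
  refine tendsto_integral_filter_of_dominated_convergence
    (fun z => C * (z + 1) ^ (-(b - 1))) ?_ ?_ ?_ ?_
  · exact Eventually.of_forall fun u => (measurable_id.mul (hmeas u)).aestronglyMeasurable
  · filter_upwards [hdom] with u hu
    filter_upwards [ae_restrict_mem measurableSet_Ioi] with z hz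
    have hz : 0 < z := hz
    obtain ⟨h0, h1⟩ := hu z hz
    rw [Real.norm_of_nonneg (mul_nonneg hz.le h0)]
    have h3 := hid b z hz
    have h4 : 0 ≤ (z + 1) ^ (-b) := by positivity
    calc _ ≤ z * (C * (z + 1) ^ (-b)) := by gcongr
      _ = C * (z * (z + 1) ^ (-b)) := by ring
      _ ≤ _ := by gcongr; linarith
  · exact (aux_int (b - 1) (by linarith)).1.const_mul _
  · filter_upwards [ae_restrict_mem measurableSet_Ioi] with z hz
    exact (hpt z hz).const_mul z
end

section
/- Let q ∈ (1/2, 1), set a = 1/(1−q) (so a > 2), and let S : (0,∞) → (0,∞) be a measurable nonincreasing function with S(z) = z^{−a} l(z) for a slowly varying l. Let g : (0,∞) → (0,∞) satisfy g(u)/u → 1, and set S_{Y_u}(z) = S(z g(u) + u)/S(u). Define G_*(z) = (1+z)^{1/(q−1)} for z ≥ 0 (the maximum Tsallis entropy function with α = β = 1). Then, as u → ∞: ∫_0^∞ S_{Y_u}(z)^q dz → ∫_0^∞ G_*(z)^q dz = (1−q)/(2q−1), ∫_0^∞ S_{Y_u}(z) dz → ∫_0^∞ G_*(z) dz = (1−q)/q,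 and ∫_0^∞ z S_{Y_u}(z) dz → ∫_0^∞ z G_*(z) dz = (q−1)²/(q(2q−1)). Hence the normalized excess survival function asymptotically attains the q-norm and the moments of the unique maximum Tsallis entropy solution, the Generalized Pareto survival function G_*. -/
open MeasureTheory Set Filter

theorem aux_integrable (p : ℝ) (hp : 1 < p) :
    IntegrableOn (fun z : ℝ => (1 + z) ^ (-p)) (Ioi 0) := by
  have := integrableOn_add_rpow_Ioi_of_lt (a := -p) (c := 0) (m := 1) (by linarith) (by norm_num)
  simpa [add_comm] using this

theorem aux_integral (p : ℝ) (hp : 1 < p) :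
    ∫ z in Ioi (0:ℝ), (1 + z) ^ (-p) = 1 / (p - 1) := by
  have h : Tendsto (fun z : ℝ => (1 + z) ^ (-p+1) / (-p+1)) atTop (nhds (0 / (-p+1))) := by
    apply Tendsto.div_const
    have h1 := tendsto_rpow_neg_atTop (y := p - 1) (by linarith)
    have h2 := h1.comp (tendsto_atTop_add_const_left atTop (1:ℝ) tendsto_id)
    refine h2.congr fun z => ?_
    simp only [Function.comp, id]
    congr 1; ring
  have hne : -p + 1 ≠ 0 := by linarith
  have := integral_Ioi_of_hasDerivAt_of_tendsto' (a := (0:ℝ)) (f := fun z : ℝ => (1 + z) ^ (-p+1) / (-p+1))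
    (f' := fun z : ℝ => (1 + z) ^ (-p)) (fun x hx => by
      have hx' : (0:ℝ) ≤ x := hx
      have h0 : (1 + x) ≠ 0 := by linarith
      have := (((hasDerivAt_id x).const_add 1).rpow_const (p := -p+1) (Or.inl h0)).div_const (-p+1)
      refine HasDerivAt.congr_deriv this ?_
      rw [show -p + 1 - 1 = -p by ring, one_mul, mul_comm, mul_div_assoc, div_self hne, mul_one]
      rfl) (aux_integrable p hp) h
  rw [this]
  simp
  rw [show -p + 1 = -(p - 1) by ring, inv_neg, neg_neg]

theorem aux_potter_s12 (S : ℝ → ℝ) (hSpos : ∀ z, 0 < z → 0 < S z)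
    (hSmono : AntitoneOn S (Ioi 0)) (b : ℝ) (hb : 0 < b) (u0 : ℝ) (hu0 : 0 < u0)
    (h2 : ∀ x, u0 ≤ x → S (2 * x) ≤ 2 ^ (-b) * S x) (x t : ℝ) (hx : u0 ≤ x) (ht : 1 ≤ t) :
    S (t * x) ≤ 2 ^ b * t ^ (-b) * S x := by
  have hx0 : 0 < x := by linarith
  have hpow : ∀ n : ℕ, S (2 ^ n * x) ≤ ((2:ℝ) ^ n) ^ (-b) * S x := by
    intro n
    induction n with
    | zero => simp
    | succ n ih =>
      have h1 : (1:ℝ) ≤ 2 ^ n := one_le_pow₀ (by norm_num)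
      have := h2 (2 ^ n * x) (by nlinarith)
      calc S (2 ^ (n+1) * x) = S (2 * (2 ^ n * x)) := by congr 1; ring
        _ ≤ 2 ^ (-b) * S (2 ^ n * x) := this
        _ ≤ 2 ^ (-b) * (((2:ℝ) ^ n) ^ (-b) * S x) := by gcongr
        _ = _ := by rw [pow_succ, Real.mul_rpow (by positivity) (by positivity)]; ring
  obtain ⟨n, hn1, hn2⟩ := exists_nat_pow_near ht (by norm_num : (1:ℝ) < 2)
  have hSx := hSpos x hx0
  calc S (t * x) ≤ S (2 ^ n * x) := hSmono (by simp; positivity) (by simp; positivity) (by gcongr)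
    _ ≤ ((2:ℝ) ^ n) ^ (-b) * S x := hpow n
    _ ≤ (t / 2) ^ (-b) * S x := by
        gcongr ?_ * _
        apply Real.rpow_le_rpow_of_nonpos (by positivity) _ (by linarith)
        rw [pow_succ] at hn2; linarith
    _ = _ := by
        rw [Real.div_rpow (by positivity) (by norm_num), Real.rpow_neg (by norm_num : (0:ℝ) ≤ 2)]
        field_simp

theorem aux_ratio (a : ℝ) (S l : ℝ → ℝ) 
    (hlpos : ∀ z, 0 < z → 0 < l z)
    (hlslow : ∀ t, 0 < t → Tendsto (fun z => l (t * z) / l z) atTop (nhds 1))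
    (hS : ∀ z, 0 < z → S z = z ^ (-a) * l z) (t : ℝ) (ht : 0 < t) :
    Tendsto (fun u => S (t * u) / S u) atTop (nhds (t ^ (-a))) := by
  have := (hlslow t ht).const_mul (t ^ (-a))
  rw [mul_one] at this
  refine this.congr' ?_
  filter_upwards [eventually_gt_atTop 0] with u hu
  rw [hS _ (by positivity), hS _ hu, Real.mul_rpow ht.le hu.le]
  have := hlpos u hu
  have := Real.rpow_pos_of_pos hu (-a)
  field_simp

theorem aux_pointwise (a : ℝ) (S : ℝ → ℝ) (hSpos : ∀ z, 0 < z → 0 < S z)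
    (hSmono : AntitoneOn S (Ioi 0))
    (hr : ∀ t, 0 < t → Tendsto (fun u => S (t * u) / S u) atTop (nhds (t ^ (-a))))
    (c : ℝ → ℝ) (t : ℝ) (ht : 0 < t) (hc : Tendsto c atTop (nhds t)) :
    Tendsto (fun u => S (c u * u) / S u) atTop (nhds (t ^ (-a))) := by
  have hcont : ContinuousAt (fun s : ℝ => s ^ (-a)) t :=
    Real.continuousAt_rpow_const _ _ (Or.inl ht.ne')
  rw [tendsto_order]
  constructor
  · intro y hy
    have h1 := (hcont.tendsto.eventually (lt_mem_nhds hy)).filter_mono (nhdsWithin_le_nhds (s := Ioi t))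
    obtain ⟨s, hs, hst⟩ := (h1.and self_mem_nhdsWithin).exists
    have hst : t < s := hst
    filter_upwards [(hr s (ht.trans hst)).eventually (lt_mem_nhds hs), hc.eventually (gt_mem_nhds hst),
      hc.eventually (lt_mem_nhds ht), eventually_gt_atTop 0] with u h1 h2 h3 h4
    refine h1.trans_le ?_
    have := hSpos u h4
    gcongr
    apply hSmono (by simp; positivity) (by simp only [mem_Ioi]; have := ht.trans hst; positivity) (by gcongr)
  · intro y hy
    have h1 := (hcont.tendsto.eventually (gt_mem_nhds hy)).filter_mono (nhdsWithin_le_nhds (s := Iio t))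
    obtain ⟨s, ⟨hs, hst⟩, hs0⟩ := ((h1.and self_mem_nhdsWithin).and
      ((lt_mem_nhds ht).filter_mono nhdsWithin_le_nhds)).exists
    have hst : s < t := hst
    filter_upwards [(hr s hs0).eventually (gt_mem_nhds hs), hc.eventually (lt_mem_nhds hst),
      eventually_gt_atTop 0] with u h1 h2 h4
    refine lt_of_le_of_lt ?_ h1
    have := hSpos u h4
    gcongr
    apply hSmono (by simp; positivity) (by simp only [mem_Ioi]; have := hs0.trans h2; positivity) (by gcongr)

/-- Uniform domination of the normalized excess survival function. -/
theorem aux_dom (a : ℝ) (S : ℝ → ℝ) (hSpos : ∀ z, 0 < z → 0 < S z)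
    (hSmono : AntitoneOn S (Ioi 0))
    (hr : ∀ t, 0 < t → Tendsto (fun u => S (t * u) / S u) atTop (nhds (t ^ (-a))))
    (g : ℝ → ℝ) (hg : Tendsto (fun u => g u / u) atTop (nhds 1))
    (b : ℝ) (hb : 0 < b) (hba : b < a) :
    ∃ C : ℝ, 0 < C ∧ ∀ᶠ u in atTop, ∀ z, 0 < z →
      0 ≤ S (z * g u + u) / S u ∧ S (z * g u + u) / S u ≤ C * (1 + z) ^ (-b) := by
  have hlt : (2:ℝ) ^ (-a) < 2 ^ (-b) :=
    Real.rpow_lt_rpow_of_exponent_lt (by norm_num) (by linarith)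
  obtain ⟨u1, hu1⟩ := eventually_atTop.1 ((hr 2 (by norm_num)).eventually (gt_mem_nhds hlt))
  have h2 : ∀ x, max u1 1 ≤ x → S (2 * x) ≤ 2 ^ (-b) * S x := by
    intro x hx
    have hx0 : 0 < x := by linarith [le_max_right u1 1]
    have := hu1 x ((le_max_left _ _).trans hx)
    rw [div_lt_iff₀ (hSpos x hx0)] at this
    exact this.le
  refine ⟨2 ^ b * 2 ^ b, by positivity, ?_⟩
  filter_upwards [eventually_ge_atTop (max u1 1),
    hg.eventually (lt_mem_nhds (show (1/2:ℝ) < 1 by norm_num))] with u hu hgu z hz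
  have hu0 : 0 < u := by linarith [le_max_right u1 1]
  have hSu := hSpos u hu0
  rw [lt_div_iff₀ hu0] at hgu
  have hle : (1 + z) / 2 * u ≤ z * g u + u := by nlinarith
  have hle' : (1 + z / 2) * u ≤ z * g u + u := by nlinarith
  have hpos : 0 < z * g u + u := by nlinarith
  refine ⟨by have := hSpos _ hpos; positivity, ?_⟩
  rw [div_le_iff₀ hSu]
  calc S (z * g u + u) ≤ S ((1 + z / 2) * u) :=
        hSmono (by simp only [mem_Ioi]; positivity) (by simpa using hpos) hle'
    _ ≤ 2 ^ b * (1 + z / 2) ^ (-b) * S u :=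
        aux_potter_s12 S hSpos hSmono b hb _ (by positivity) h2 u _ hu (by linarith)
    _ ≤ 2 ^ b * ((1 + z) / 2) ^ (-b) * S u := by
        gcongr _ * ?_ * _
        exact Real.rpow_le_rpow_of_nonpos (by positivity) (by linarith) (by linarith)
    _ = _ := by
        rw [Real.div_rpow (by positivity) (by norm_num), Real.rpow_neg (by norm_num : (0:ℝ) ≤ 2)]
        field_simp

theorem aux_dct (F : ℝ → ℝ → ℝ) (f : ℝ → ℝ) (K p : ℝ) (hp : 1 < p)
    (hm : ∀ u, Measurable (F u))
    (hb : ∀ᶠ u in atTop, ∀ z, 0 < z → 0 ≤ F u z ∧ F u z ≤ K * (1 + z) ^ (-p))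
    (hl : ∀ z, 0 < z → Tendsto (fun u => F u z) atTop (nhds (f z))) :
    Tendsto (fun u => ∫ z in Ioi (0:ℝ), F u z) atTop (nhds (∫ z in Ioi (0:ℝ), f z)) := by
  refine tendsto_integral_filter_of_dominated_convergence (fun z => K * (1 + z) ^ (-p)) 
    (Eventually.of_forall fun u => (hm u).aestronglyMeasurable) ?_
    ((aux_integrable p hp).const_mul K) ?_
  · filter_upwards [hb] with u hu
    filter_upwards [ae_restrict_mem measurableSet_Ioi] with z hz
    rw [Real.norm_of_nonneg (hu z hz).1]
    exact (hu z hz).2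
  · filter_upwards [ae_restrict_mem measurableSet_Ioi] with z hz
    exact hl z hz

/-- Entropic view of Pickands' theorem, Fréchet case: for `1/2 < q < 1` and a survival
function `S` in the Fréchet domain of attraction with tail index `a = 1/(1-q)`, the
`q`-norm (to the `q`-th power), the 1-norm and the first moment of the normalized excess
survival function `S_{Y_u}(z) = S(z g(u) + u)/S(u)` converge, as `u → ∞`, to the
corresponding quantities of the maximum Tsallis entropy solution
`G_*(z) = (1+z)^{1/(q-1)}` (the GPD with `α = β = 1`). -/
theorem frechet_excess_max_tsallis_entropy
    (q : ℝ) (hq1 : 1 / 2 < q) (hq2 : q < 1)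
    (a : ℝ) (ha : a = 1 / (1 - q))
    (S l : ℝ → ℝ) (hSmeas : Measurable S)
    (hSpos : ∀ z, 0 < z → 0 < S z)
    (hSmono : AntitoneOn S (Ioi 0))
    (hlpos : ∀ z, 0 < z → 0 < l z)
    (hlslow : ∀ t, 0 < t → Tendsto (fun z => l (t * z) / l z) atTop (nhds 1))
    (hS : ∀ z, 0 < z → S z = z ^ (-a) * l z)
    (g : ℝ → ℝ) (hgpos : ∀ u, 0 < u → 0 < g u)
    (hg : Tendsto (fun u => g u / u) atTop (nhds 1))
    (Gstar : ℝ → ℝ) (hGstar : ∀ z, 0 ≤ z → Gstar z = (1 + z) ^ (1 / (q - 1))) :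
    (Tendsto (fun u => ∫ z in Ioi (0 : ℝ), (S (z * g u + u) / S u) ^ q)
        atTop (nhds (∫ z in Ioi (0 : ℝ), Gstar z ^ q)) ∧
      ∫ z in Ioi (0 : ℝ), Gstar z ^ q = (1 - q) / (2 * q - 1)) ∧
    (Tendsto (fun u => ∫ z in Ioi (0 : ℝ), S (z * g u + u) / S u)
        atTop (nhds (∫ z in Ioi (0 : ℝ), Gstar z)) ∧
      ∫ z in Ioi (0 : ℝ), Gstar z = (1 - q) / q) ∧
    (Tendsto (fun u => ∫ z in Ioi (0 : ℝ), z * (S (z * g u + u) / S u))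
        atTop (nhds (∫ z in Ioi (0 : ℝ), z * Gstar z)) ∧
      ∫ z in Ioi (0 : ℝ), z * Gstar z = (q - 1) ^ 2 / (q * (2 * q - 1))) := by
  have h1q : 0 < 1 - q := by linarith
  have ha2 : 2 < a := by rw [ha, lt_div_iff₀ h1q]; linarith
  have haq : a * (1 - q) = 1 := by rw [ha]; field_simp
  have he : 1 / (q - 1) = -a := by
    rw [ha, show q - 1 = -(1 - q) by ring, one_div, one_div, inv_neg]
  have hr := aux_ratio a S l hlpos hlslow hS
  obtain ⟨b, hb2, hba⟩ := exists_between ha2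
  obtain ⟨C, hC, hdom⟩ := aux_dom a S hSpos hSmono hr g hg b (by linarith) hba
  have hpt : ∀ z, 0 < z → Tendsto (fun u => S (z * g u + u) / S u) atTop (nhds (Gstar z)) := by
    intro z hz
    rw [hGstar z hz.le, he]
    have hc : Tendsto (fun u => 1 + z * (g u / u)) atTop (nhds (1 + z)) := by
      simpa using (hg.const_mul z).const_add 1
    refine (aux_pointwise a S hSpos hSmono hr _ (1 + z) (by linarith) hc).congr' ?_
    filter_upwards [eventually_gt_atTop 0] with u hu
    congr 2
    field_simp
    ring
  have hmeas : ∀ u, Measurable (fun z => S (z * g u + u) / S u) := by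
    intro u
    exact (hSmeas.comp (by fun_prop)).div_const _
  have hGpos : ∀ z, 0 < z → 0 < Gstar z := by
    intro z hz
    rw [hGstar z hz.le]
    positivity
  have haq1 : 1 < a * q := by nlinarith
  refine ⟨⟨?_, ?_⟩, ⟨?_, ?_⟩, ⟨?_, ?_⟩⟩
  · refine aux_dct _ _ (C ^ q) (b * q) (by nlinarith) (fun u => (hmeas u).pow_const q) ?_ ?_
    · filter_upwards [hdom] with u hu z hz
      obtain ⟨h0, h1⟩ := hu z hz
      refine ⟨Real.rpow_nonneg h0 q, ?_⟩
      calc _ ≤ (C * (1 + z) ^ (-b)) ^ q := Real.rpow_le_rpow h0 h1 (by linarith)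
        _ = _ := by
          rw [Real.mul_rpow hC.le (by positivity), ← Real.rpow_mul (by positivity), neg_mul]
    · intro z hz
      exact (hpt z hz).rpow_const (Or.inl (hGpos z hz).ne')
  · have : ∫ z in Ioi (0 : ℝ), Gstar z ^ q = ∫ z in Ioi (0 : ℝ), (1 + z) ^ (-(a * q)) := by
      refine setIntegral_congr_fun measurableSet_Ioi fun z hz => ?_
      have hz : 0 < z := hz
      rw [hGstar z hz.le, he, ← Real.rpow_mul (by positivity), neg_mul]
    rw [this, aux_integral _ haq1, div_eq_div_iff (by linarith) (by linarith)]
    linear_combination (-q) * haq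
  · refine aux_dct _ _ C b (by linarith) hmeas hdom hpt
  · have : ∫ z in Ioi (0 : ℝ), Gstar z = ∫ z in Ioi (0 : ℝ), (1 + z) ^ (-a) := by
      refine setIntegral_congr_fun measurableSet_Ioi fun z hz => ?_
      have hz : 0 < z := hz
      rw [hGstar z hz.le, he]
    rw [this, aux_integral _ (by linarith), div_eq_div_iff (by linarith) (by linarith)]
    linear_combination -haq
  · refine aux_dct _ _ C (b - 1) (by linarith) (fun u => measurable_id.mul (hmeas u)) ?_ ?_
    · filter_upwards [hdom] with u hu z hz
      obtain ⟨h0, h1⟩ := hu z hz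
      refine ⟨mul_nonneg hz.le h0, ?_⟩
      calc _ ≤ (1 + z) * (C * (1 + z) ^ (-b)) := by
            refine mul_le_mul (by simp) h1 h0 (by positivity)
        _ = _ := by
          rw [show -(b - 1) = -b + 1 by ring, Real.rpow_add_one (by positivity)]
          ring
    · intro z hz
      exact (hpt z hz).const_mul z
  · have : ∫ z in Ioi (0 : ℝ), z * Gstar z
        = ∫ z in Ioi (0 : ℝ), ((1 + z) ^ (-(a - 1)) - (1 + z) ^ (-a)) := by
      refine setIntegral_congr_fun measurableSet_Ioi fun z hz => ?_
      have hz : 0 < z := hz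
      rw [hGstar z hz.le, he, show -(a - 1) = -a + 1 by ring, Real.rpow_add_one (by positivity)]
      ring
    rw [this, integral_sub (aux_integrable _ (by linarith)) (aux_integrable _ (by linarith)),
      aux_integral _ (by linarith), aux_integral _ (by linarith), ha]
    have hx1 : 1 / (1 - q) - 1 = q / (1 - q) := by field_simp; ring
    have hx2 : 1 / (1 - q) - 1 - 1 = (2 * q - 1) / (1 - q) := by field_simp; ring
    rw [hx2, hx1]
    have : 2 * q - 1 ≠ 0 := by linarith
    have : q ≠ 0 := by linarith
    field_simp
    ring
end
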